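/- arXiv:math/0106040 — 3 statements merged into one kernel-verified Lean document; each statement's English description precedes it below -/
import Mathlib

section
/- For all integers p and q, the strands S^{p,q} and S^{p+2q,0} are ambient isotopic in ℝ⁴. -/
/-- ℝ⁴, the ambient space. -/
abbrev R4 : Type := Fin 4 → ℝ

/-- A (possibly empty, possibly disconnected) closed surface in ℝ⁴:
a compact subset which is a topological 2-manifold. -/
def IsClosedSurface (S : Set R4) : Prop :=
  IsCompact S ∧ Nonempty (ChartedSpace (EuclideanSpace ℝ (Fin 2)) S)

/-- An `n`-component surface-link, given by its labelled components. -/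
def IsSurfaceLinkFam {n : ℕ} (F : Fin n → Set R4) : Prop :=
  (∀ i, IsClosedSurface (F i)) ∧ ∀ i j, i ≠ j → Disjoint (F i) (F j)

/-- Unoriented bordism of `n`-component surface-links: a compact 3-manifold
`W = W₁ ∪ … ∪ W_n` properly embedded in ℝ⁴ × [0,1] with
`∂Wᵢ = Fᵢ × {0} ∪ F'ᵢ × {1}`. -/
def UnorientedBordant {n : ℕ} (F F' : Fin n → Set R4) : Prop :=
  ∃ W : Fin n → Set (R4 × ℝ),
    (∀ i, IsCompact (W i)) ∧
    (∀ i, Nonempty (ChartedSpace (EuclideanHalfSpace 3) (W i))) ∧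
    (∀ i j, i ≠ j → Disjoint (W i) (W j)) ∧
    (∀ i, ∀ p ∈ W i, p.2 ∈ Set.Icc (0:ℝ) 1) ∧
    (∀ i, {x : R4 | (x, (0:ℝ)) ∈ W i} = F i) ∧
    (∀ i, {x : R4 | (x, (1:ℝ)) ∈ W i} = F' i)

/-- Ambient isotopy of `n`-component surface-links in ℝ⁴. -/
def AmbientIsotopic {n : ℕ} (F F' : Fin n → Set R4) : Prop :=
  ∃ H : ℝ → (R4 ≃ₜ R4),
    Continuous (fun q : R4 × ℝ => H q.2 q.1) ∧
    Continuous (fun q : R4 × ℝ => (H q.2).symm q.1) ∧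
    H 0 = Homeomorph.refl R4 ∧
    ∀ i, ⇑(H 1) '' F i = F' i

/-- `A` and `B` are separated by a hyperplane `x₀ = a` (disjoint half-spaces). -/
def HalfSep (A B : Set R4) : Prop :=
  ∃ a : ℝ, (∀ x ∈ A, x 0 < a) ∧ ∀ y ∈ B, a < y 0

/-- The translated copy of the piece `L s` in a split union. -/
def pieceSet {n : ℕ} {ι : Type*} (L : ι → Fin n → Set R4) (v : ι → R4) (s : ι) : Set R4 :=
  ⋃ a, (fun x => x + v s) '' L s a

/-- `G` is a split union of the family of labelled links `L`: the pieces are translated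
into pairwise disjoint half-spaces, and components with equal labels are merged. -/
def SplitUnionOf {n : ℕ} {ι : Type*} (G : Fin n → Set R4) (L : ι → Fin n → Set R4) : Prop :=
  ∃ v : ι → R4,
    (∀ s s' : ι, s ≠ s' →
      HalfSep (pieceSet L v s) (pieceSet L v s') ∨ HalfSep (pieceSet L v s') (pieceSet L v s)) ∧
    ∀ a, G a = ⋃ s, (fun x => x + v s) '' L s a
/-- Rotation of ℝ³ by angle θ about the z-axis. -/
noncomputable def rotZ (θ : ℝ) (v : Fin 3 → ℝ) : Fin 3 → ℝ :=
  ![v 0 * Real.cos θ - v 1 * Real.sin θ, v 0 * Real.sin θ + v 1 * Real.cos θ, v 2]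

/-- Rotation of ℝ³ by angle θ about the axis `{y = 0, z = 2}`. -/
noncomputable def rotAx (θ : ℝ) (v : Fin 3 → ℝ) : Fin 3 → ℝ :=
  ![v 0, v 1 * Real.cos θ - (v 2 - 2) * Real.sin θ,
    2 + v 1 * Real.sin θ + (v 2 - 2) * Real.cos θ]

/-- The spinning map μ : ℝ³₊ × [0,1] → ℝ⁴. -/
noncomputable def spinMap (v : Fin 3 → ℝ) (s : ℝ) : R4 :=
  ![v 0, v 1, v 2 * Real.cos (2 * Real.pi * s), v 2 * Real.sin (2 * Real.pi * s)]

/-- The first component `k₁` of a Hopf link inside the ball B³ of radius 1 about (0,0,2),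
invariant under the 180°-rotation about the z-axis. -/
def hopfK1 : Set (Fin 3 → ℝ) :=
  {v | v 1 = 0 ∧ (v 0) ^ 2 + (v 2 - 2) ^ 2 = (1 / 4) ^ 2}

/-- The second component `k₂` of the Hopf link, also invariant under the
180°-rotation about the z-axis. -/
def hopfK2 : Set (Fin 3 → ℝ) :=
  {v | v 0 = 0 ∧ (v 1) ^ 2 + (v 2 - 9 / 4) ^ 2 = (1 / 4) ^ 2}

/-- One component of the strand `S^{p,q}`: spin the Hopf link component `k`
while performing the motion `f^p·g^q` (`f` = 180°-rotation about the z-axis,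
`g` = 360°-rotation about the axis `{y = 0, z = 2}`). -/
def strandSet (p q : ℤ) (k : Set (Fin 3 → ℝ)) : Set R4 :=
  {w | ∃ s ∈ Set.Icc (0:ℝ) 1, ∃ v ∈ k,
    w = spinMap (rotZ ((p : ℝ) * Real.pi * s) (rotAx ((q : ℝ) * (2 * Real.pi) * s) v)) s}

/-- The strand `S^{p,q} = T₁ ∪ T₂` as a 2-component surface-link. -/
def strandFam (p q : ℤ) : Fin 2 → Set R4 :=
  ![strandSet p q hopfK1, strandSet p q hopfK2]

/-- A bead: the 2-sphere `μ(∂B³ × {t})`. -/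
def beadSet (t : ℝ) : Set R4 :=
  {w | ∃ v : Fin 3 → ℝ, (v 0) ^ 2 + (v 1) ^ 2 + (v 2 - 2) ^ 2 = 1 ∧ w = spinMap v t}

/-- The labelled necklace `N^p(i,j;k₁,…,k_m)` as an `n`-component surface-link:
the strand `S^p = T₁ ∪ T₂` with `α(T₁) = i`, `α(T₂) = j`, together with beads
`B_s = μ(∂B³ × {τ s})` labelled `k s`. -/
def necklaceFam (n : ℕ) (p : ℤ) (i j : Fin n) {m : ℕ} (τ : Fin m → ℝ) (k : Fin m → Fin n) :
    Fin n → Set R4 :=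
  fun a =>
    (⋃ (_ : a = i), strandSet p 0 hopfK1) ∪
    (⋃ (_ : a = j), strandSet p 0 hopfK2) ∪
    ⋃ (s : Fin m), ⋃ (_ : a = k s), beadSet (τ s)
open Matrix in
/-- Affine map with linear part `M` fixing the centre `(0,0,2)`. -/
noncomputable def rotC (M : Matrix (Fin 3) (Fin 3) ℝ) (v : Fin 3 → ℝ) : Fin 3 → ℝ :=
  ![0, 0, 2] + M *ᵥ (v - ![0, 0, 2])

/-- Squared distance to the centre. -/
noncomputable def sqC (v : Fin 3 → ℝ) : ℝ := (v - ![0, 0, 2]) ⬝ᵥ (v - ![0, 0, 2])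

/-- Cutoff. -/
noncomputable def cutC (v : Fin 3 → ℝ) : ℝ := max 0 (min 1 (2 - 2 * sqC v))

lemma sqC_eq (v : Fin 3 → ℝ) : sqC v = v 0 ^ 2 + v 1 ^ 2 + (v 2 - 2) ^ 2 := by
  simp [sqC, dotProduct, Fin.sum_univ_three]; ring

lemma sqC_rotC {M : Matrix (Fin 3) (Fin 3) ℝ} (h : M.transpose * M = 1) (v : Fin 3 → ℝ) :
    sqC (rotC M v) = sqC v := by
  unfold sqC rotC
  rw [add_sub_cancel_left, Matrix.dotProduct_mulVec, Matrix.vecMul_mulVec, h,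
    Matrix.vecMul_one]

lemma rotC_rotC (M N : Matrix (Fin 3) (Fin 3) ℝ) (v : Fin 3 → ℝ) :
    rotC M (rotC N v) = rotC (M * N) v := by
  unfold rotC
  rw [add_sub_cancel_left, Matrix.mulVec_mulVec]

lemma rotC_one (v : Fin 3 → ℝ) : rotC 1 v = v := by
  unfold rotC; rw [Matrix.one_mulVec, add_sub_cancel]

lemma continuous_sqC : Continuous sqC := by
  unfold sqC; fun_prop

lemma continuous_cutC : Continuous cutC := by
  have := continuous_sqC
  unfold cutC; fun_prop

lemma cutC_zero {v : Fin 3 → ℝ} (h : 1 ≤ sqC v) : cutC v = 0 := by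
  unfold cutC
  exact max_eq_left ((min_le_right _ _).trans (by linarith))

lemma cutC_one {v : Fin 3 → ℝ} (h : sqC v ≤ 1 / 2) : cutC v = 1 := by
  unfold cutC
  rw [min_eq_left (by linarith), max_eq_right zero_le_one]

/-- The complex number given by the last two coordinates. -/
noncomputable def cpx (w : R4) : ℂ := ⟨w 2, w 3⟩

lemma continuous_cpx : Continuous cpx := by
  have : cpx = fun w : R4 => (w 2 : ℂ) + (w 3 : ℂ) * Complex.I := by
    funext w; apply Complex.ext <;> simp [cpx]
  rw [this]; fun_prop

noncomputable def base (w : R4) : Fin 3 → ℝ := ![w 0, w 1, ‖cpx w‖]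

noncomputable def ang (w : R4) : ℝ := Complex.arg (cpx w) / (2 * Real.pi)

lemma continuous_base : Continuous base := by
  have := continuous_cpx
  unfold base
  refine continuous_pi fun i => ?_
  fin_cases i <;> simp <;> fun_prop

lemma spin_base_ang (w : R4) : spinMap (base w) (ang w) = w := by
  have hpi : 2 * Real.pi * (Complex.arg (cpx w) / (2 * Real.pi)) = Complex.arg (cpx w) := by
    field_simp
  have h1 : ‖cpx w‖ * Real.cos (Complex.arg (cpx w)) = w 2 := by
    rw [Complex.norm_mul_cos_arg]; rfl
  have h2 : ‖cpx w‖ * Real.sin (Complex.arg (cpx w)) = w 3 := by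
    rw [Complex.norm_mul_sin_arg]; rfl
  funext i
  fin_cases i <;> simp [spinMap, base, ang, hpi, h1, h2]

lemma cpx_spin (v : Fin 3 → ℝ) (s : ℝ) :
    cpx (spinMap v s) = (v 2 : ℂ) * ((Real.cos (2 * Real.pi * s) : ℝ)
      + (Real.sin (2 * Real.pi * s) : ℝ) * Complex.I) := by
  apply Complex.ext
  · simp only [Complex.re_ofReal_mul, Complex.add_re, Complex.ofReal_re, Complex.mul_re,
      Complex.I_re, Complex.I_im, Complex.ofReal_im]
    simp [cpx, spinMap]
  · simp only [Complex.im_ofReal_mul, Complex.add_im, Complex.ofReal_re, Complex.mul_im,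
      Complex.I_re, Complex.I_im, Complex.ofReal_im]
    simp [cpx, spinMap]

lemma base_spin {v : Fin 3 → ℝ} (hv : 0 ≤ v 2) (s : ℝ) : base (spinMap v s) = v := by
  have : ‖cpx (spinMap v s)‖ = v 2 := by
    rw [cpx_spin, norm_mul, Complex.ofReal_cos, Complex.ofReal_sin, Complex.norm_cos_add_sin_mul_I]
    simp [abs_of_nonneg hv]
  funext i
  fin_cases i <;> simp [base, this] <;> simp [spinMap]

lemma ang_spin {v : Fin 3 → ℝ} (hv : 0 < v 2) (s : ℝ) :
    ∃ n : ℤ, ang (spinMap v s) = s + n := by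
  have h := cpx_spin v s
  have h2 : ((Complex.arg (cpx (spinMap v s)) : ℝ) : Real.Angle)
      = ((2 * Real.pi * s : ℝ) : Real.Angle) := by
    rw [h]
    have h3 := Complex.arg_mul_cos_add_sin_mul_I_coe_angle hv ((2 * Real.pi * s : ℝ) : Real.Angle)
    rwa [Real.Angle.cos_coe, Real.Angle.sin_coe] at h3
  rw [Real.Angle.angle_eq_iff_two_pi_dvd_sub] at h2
  obtain ⟨k, hk⟩ := h2
  refine ⟨k, ?_⟩
  unfold ang
  rw [div_eq_iff (by positivity)]
  linarith

lemma per_int {X Y : Type*} (G : X → ℝ → Y) (hper : ∀ x s, G x (s + 1) = G x s)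
    (x : X) (s : ℝ) (n : ℤ) : G x (s + n) = G x s := by
  have : Function.Periodic (G x) 1 := hper x
  simpa using this.int_mul n s

lemma continuousAt_arg_per {X Y Z : Type*} [TopologicalSpace X] [TopologicalSpace Y]
    [TopologicalSpace Z] (G : X → ℝ → Y) (hG : Continuous (fun q : X × ℝ => G q.1 q.2))
    (hper : ∀ x s, G x (s + 1) = G x s) (f : Z → X) (c : Z → ℂ)
    (hf : Continuous f) (hc : Continuous c) (z : Z) (hz : c z ≠ 0) :
    ContinuousAt (fun y => G (f y) (Complex.arg (c y) / (2 * Real.pi))) z := by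
  by_cases hs : c z ∈ Complex.slitPlane
  · have h1 : ContinuousAt (fun y => Complex.arg (c y) / (2 * Real.pi)) z :=
      ((Complex.continuousAt_arg hs).comp hc.continuousAt).div_const _
    exact hG.continuousAt.comp (f := fun y => (f y, Complex.arg (c y) / (2 * Real.pi)))
      (hf.continuousAt.prodMk h1)
  · have hs' : -c z ∈ Complex.slitPlane := by
      rw [Complex.mem_slitPlane_iff] at hs ⊢
      push Not at hs
      left
      have : (c z).re ≠ 0 := fun h => hz (Complex.ext h hs.2)
      have := lt_of_le_of_ne hs.1 this
      simpa using this
    have h1 : ContinuousAt (fun y => Complex.arg (-c y) / (2 * Real.pi) + 1 / 2) z :=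
      (((Complex.continuousAt_arg hs').comp
        (f := fun y => -c y) hc.neg.continuousAt).div_const _).add_const _
    have h2 : ContinuousAt (fun y => G (f y) (Complex.arg (-c y) / (2 * Real.pi) + 1 / 2)) z :=
      hG.continuousAt.comp (f := fun y => (f y, Complex.arg (-c y) / (2 * Real.pi) + 1 / 2))
        (hf.continuousAt.prodMk h1)
    refine h2.congr ?_
    filter_upwards [hc.continuousAt.eventually_ne hz] with y hy
    have h3 := Complex.arg_neg_coe_angle hy
    rw [← Real.Angle.coe_add, Real.Angle.angle_eq_iff_two_pi_dvd_sub] at h3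
    obtain ⟨k, hk⟩ := h3
    have : Complex.arg (-c y) / (2 * Real.pi) + 1 / 2
        = Complex.arg (c y) / (2 * Real.pi) + ((k + 1 : ℤ) : ℝ) := by
      have hp := Real.pi_pos
      have : Complex.arg (-c y) = Complex.arg (c y) + Real.pi + 2 * Real.pi * k := by linarith
      rw [this]; push_cast; field_simp; ring
    rw [this, per_int G hper]

/-- A family of rotations of the ball, as a function of isotopy parameter and angle. -/
structure GoodFam (M : ℝ → ℝ → Matrix (Fin 3) (Fin 3) ℝ) : Prop where
  cont : Continuous (fun q : ℝ × ℝ => M q.1 q.2)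
  orth : ∀ u s, (M u s).transpose * M u s = 1
  per : ∀ u s, M u (s + 1) = M u s
  zero : ∀ s, M 0 s = 1

lemma GoodFam.transpose {M : ℝ → ℝ → Matrix (Fin 3) (Fin 3) ℝ} (h : GoodFam M) :
    GoodFam (fun u s => (M u s).transpose) where
  cont := h.cont.matrix_transpose
  orth u s := by
    rw [Matrix.transpose_transpose]; exact mul_eq_one_comm.mp (h.orth u s)
  per u s := by rw [h.per]
  zero s := by rw [h.zero, Matrix.transpose_one]

/-- The ambient map. -/
noncomputable def amb (M : ℝ → ℝ → Matrix (Fin 3) (Fin 3) ℝ) (t : ℝ) (w : R4) : R4 :=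
  spinMap (rotC (M (t * cutC (base w)) (ang w)) (base w)) (ang w)

lemma spin_per (v : Fin 3 → ℝ) (s : ℝ) : spinMap v (s + 1) = spinMap v s := by
  have : 2 * Real.pi * (s + 1) = 2 * Real.pi * s + 2 * Real.pi := by ring
  simp only [spinMap, this, Real.cos_add_two_pi, Real.sin_add_two_pi]

lemma continuous_spin : Continuous (fun q : (Fin 3 → ℝ) × ℝ => spinMap q.1 q.2) := by
  unfold spinMap
  refine continuous_pi fun i => ?_
  fin_cases i <;> simp <;> fun_prop

lemma amb_spin {M : ℝ → ℝ → Matrix (Fin 3) (Fin 3) ℝ} (h : GoodFam M) (t : ℝ)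
    {v : Fin 3 → ℝ} (hv : 0 ≤ v 2) (s : ℝ) :
    amb M t (spinMap v s) = spinMap (rotC (M (t * cutC v) s) v) s := by
  unfold amb
  rw [base_spin hv]
  rcases hv.eq_or_lt with h0 | hpos
  · have : cutC v = 0 := cutC_zero (by rw [sqC_eq, ← h0]; nlinarith [sq_nonneg (v 0), sq_nonneg (v 1)])
    rw [this, mul_zero, h.zero, h.zero, rotC_one]
    have := spin_base_ang (spinMap v s)
    rwa [base_spin hv] at this
  · obtain ⟨n, hn⟩ := ang_spin hpos s
    rw [hn, per_int M h.per, per_int spinMap spin_per]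

lemma rot_nonneg {M : ℝ → ℝ → Matrix (Fin 3) (Fin 3) ℝ} (h : GoodFam M) (t : ℝ)
    {v : Fin 3 → ℝ} (hv : 0 ≤ v 2) (s : ℝ) : 0 ≤ rotC (M (t * cutC v) s) v 2 := by
  by_cases h1 : 1 ≤ sqC v
  · rw [cutC_zero h1, mul_zero, h.zero, rotC_one]; exact hv
  · push Not at h1
    rw [← sqC_rotC (h.orth (t * cutC v) s), sqC_eq] at h1
    nlinarith [sq_nonneg (rotC (M (t * cutC v) s) v 0), sq_nonneg (rotC (M (t * cutC v) s) v 1)]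

lemma amb_left_inv {M N : ℝ → ℝ → Matrix (Fin 3) (Fin 3) ℝ} (h : GoodFam M) (h' : GoodFam N)
    (hNM : ∀ u s, N u s * M u s = 1) (t : ℝ) (w : R4) : amb N t (amb M t w) = w := by
  have hb : 0 ≤ base w 2 := by simp [base]
  conv_lhs => rw [← spin_base_ang w]
  rw [amb_spin h t hb, amb_spin h' t (rot_nonneg h t hb _), rotC_rotC]
  have : cutC (rotC (M (t * cutC (base w)) (ang w)) (base w)) = cutC (base w) := by
    unfold cutC; rw [sqC_rotC (h.orth _ _)]
  rw [this, hNM, rotC_one, spin_base_ang]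

lemma continuous_amb {M : ℝ → ℝ → Matrix (Fin 3) (Fin 3) ℝ} (h : GoodFam M) :
    Continuous (fun q : R4 × ℝ => amb M q.2 q.1) := by
  rw [continuous_iff_continuousAt]
  rintro ⟨w, t⟩
  by_cases hw : cpx w = 0
  · have hev : ∀ᶠ q : R4 × ℝ in nhds (w, t), ‖cpx q.1‖ < 1 := by
      have hc : Continuous (fun q : R4 × ℝ => ‖cpx q.1‖) :=
        (continuous_cpx.comp continuous_fst).norm
      exact hc.continuousAt.eventually_lt_const (by simp [hw])
    refine (continuous_fst.continuousAt).congr ?_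
    filter_upwards [hev] with q hq
    have : cutC (base q.1) = 0 := by
      apply cutC_zero
      rw [sqC_eq]
      have : base q.1 2 = ‖cpx q.1‖ := by simp [base]
      rw [this]
      nlinarith [sq_nonneg (base q.1 0), sq_nonneg (base q.1 1)]
    unfold amb
    rw [this, mul_zero, h.zero, rotC_one, spin_base_ang]
  · have hG : Continuous (fun q : (ℝ × (Fin 3 → ℝ)) × ℝ =>
        spinMap (rotC (M q.1.1 q.2) q.1.2) q.2) := by
      have hr : Continuous (fun q : (ℝ × (Fin 3 → ℝ)) × ℝ => rotC (M q.1.1 q.2) q.1.2) := ?_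
      · exact continuous_spin.comp (hr.prodMk continuous_snd)
      simp only [rotC]
      refine continuous_const.add (Continuous.matrix_mulVec ?_ (by fun_prop))
      exact h.cont.comp (f := fun q : (ℝ × (Fin 3 → ℝ)) × ℝ => (q.1.1, q.2)) (by fun_prop)
    have hb := continuous_base
    have hcut := continuous_cutC
    exact continuousAt_arg_per
      (fun (x : ℝ × (Fin 3 → ℝ)) s => spinMap (rotC (M x.1 s) x.2) s) hG
      (fun x s => by simp only [h.per, spin_per])
      (fun q : R4 × ℝ => (q.2 * cutC (base q.1), base q.1)) (fun q => cpx q.1)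
      (by fun_prop) (continuous_cpx.comp continuous_fst) (w, t) hw

/-- The ambient homeomorphism. -/
noncomputable def ambHomeo {M : ℝ → ℝ → Matrix (Fin 3) (Fin 3) ℝ} (h : GoodFam M) (t : ℝ) :
    R4 ≃ₜ R4 where
  toFun := amb M t
  invFun := amb (fun u s => (M u s).transpose) t
  left_inv w := amb_left_inv h h.transpose h.orth t w
  right_inv w := amb_left_inv h.transpose h
    (fun u s => mul_eq_one_comm.mp (h.orth u s)) t w
  continuous_toFun := (continuous_amb h).comp (f := fun w : R4 => (w, t)) (by fun_prop)
  continuous_invFun := (continuous_amb h.transpose).comp (f := fun w : R4 => (w, t)) (by fun_prop)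

noncomputable def MZ (θ : ℝ) : Matrix (Fin 3) (Fin 3) ℝ :=
  !![Real.cos θ, -Real.sin θ, 0; Real.sin θ, Real.cos θ, 0; 0, 0, 1]
noncomputable def MX (θ : ℝ) : Matrix (Fin 3) (Fin 3) ℝ :=
  !![1, 0, 0; 0, Real.cos θ, -Real.sin θ; 0, Real.sin θ, Real.cos θ]
noncomputable def MY (θ : ℝ) : Matrix (Fin 3) (Fin 3) ℝ :=
  !![Real.cos θ, 0, -Real.sin θ; 0, 1, 0; Real.sin θ, 0, Real.cos θ]

lemma rotZ_eq (θ : ℝ) (v : Fin 3 → ℝ) : rotZ θ v = rotC (MZ θ) v := by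
  funext i
  fin_cases i <;> simp [rotZ, rotC, MZ, Matrix.mulVec, Matrix.vecHead, Matrix.vecTail] <;> ring_nf

lemma rotAx_eq (θ : ℝ) (v : Fin 3 → ℝ) : rotAx θ v = rotC (MX θ) v := by
  funext i
  fin_cases i <;> simp [rotAx, rotC, MX, Matrix.mulVec, Matrix.vecHead, Matrix.vecTail] <;> ring_nf

lemma MZ_add (a b : ℝ) : MZ a * MZ b = MZ (a + b) := by
  ext i j
  fin_cases i <;> fin_cases j <;>
    simp [MZ, Matrix.mul_apply, Fin.sum_univ_three, Real.cos_add, Real.sin_add] <;> ring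

lemma MX_add (a b : ℝ) : MX a * MX b = MX (a + b) := by
  ext i j
  fin_cases i <;> fin_cases j <;>
    simp [MX, Matrix.mul_apply, Fin.sum_univ_three, Real.cos_add, Real.sin_add] <;> ring

lemma MY_add (a b : ℝ) : MY a * MY b = MY (a + b) := by
  ext i j
  fin_cases i <;> fin_cases j <;>
    simp [MY, Matrix.mul_apply, Fin.sum_univ_three, Real.cos_add, Real.sin_add] <;> ring

lemma MZ_zero : MZ 0 = 1 := by
  ext i j; fin_cases i <;> fin_cases j <;> simp [MZ]
lemma MX_zero : MX 0 = 1 := by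
  ext i j; fin_cases i <;> fin_cases j <;> simp [MX]
lemma MY_zero : MY 0 = 1 := by
  ext i j; fin_cases i <;> fin_cases j <;> simp [MY]

lemma MZ_tr (a : ℝ) : (MZ a).transpose = MZ (-a) := by
  ext i j; fin_cases i <;> fin_cases j <;> simp [MZ]
lemma MX_tr (a : ℝ) : (MX a).transpose = MX (-a) := by
  ext i j; fin_cases i <;> fin_cases j <;> simp [MX]
lemma MY_tr (a : ℝ) : (MY a).transpose = MY (-a) := by
  ext i j; fin_cases i <;> fin_cases j <;> simp [MY]

lemma MX_int (n : ℤ) : MX (n * (2 * Real.pi)) = 1 := by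
  have h2 : Real.sin (n * (2 * Real.pi)) = 0 := by
    simpa using Real.sin_add_int_mul_two_pi 0 n
  ext i j; fin_cases i <;> fin_cases j <;> simp [MX, h2]

lemma MYXY (θ : ℝ) : MY (Real.pi / 2) * MX θ * MY (-(Real.pi / 2)) = MZ θ := by
  ext i j
  fin_cases i <;> fin_cases j <;>
    simp [MY, MX, MZ, Matrix.mul_apply, Fin.sum_univ_three]

lemma continuous_MZ : Continuous MZ := by
  refine continuous_matrix fun i j => ?_
  fin_cases i <;> fin_cases j <;> simp [MZ] <;> fun_prop
lemma continuous_MX : Continuous MX := by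
  refine continuous_matrix fun i j => ?_
  fin_cases i <;> fin_cases j <;> simp [MX] <;> fun_prop
lemma continuous_MY : Continuous MY := by
  refine continuous_matrix fun i j => ?_
  fin_cases i <;> fin_cases j <;> simp [MY] <;> fun_prop

/-- The homotopy of paths of rotations, before periodization. -/
noncomputable def famB (p q : ℤ) (u s : ℝ) : Matrix (Fin 3) (Fin 3) ℝ :=
  MZ (p * Real.pi * s) * (MY (u * (Real.pi / 2)) * MX (q * (2 * Real.pi) * s)
    * MY (-(u * (Real.pi / 2)))) * (MX (-(q * (2 * Real.pi) * s)) * MZ (-(p * Real.pi * s)))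

lemma famB_at_zero (p q : ℤ) (u : ℝ) : famB p q u 0 = 1 := by
  simp [famB, MX_zero, MZ_zero, MY_add, MY_zero]

lemma famB_at_one (p q : ℤ) (u : ℝ) : famB p q u 1 = 1 := by
  have h := MX_int (-q)
  push_cast at h
  rw [neg_mul] at h
  simp [famB, MX_int, h, MZ_zero, MZ_add, MY_add, MY_zero]

lemma famB_u_zero (p q : ℤ) (s : ℝ) : famB p q 0 s = 1 := by
  simp only [famB, zero_mul, neg_zero, MY_zero, one_mul, mul_one]
  rw [mul_assoc, ← mul_assoc (MX _), MX_add, add_neg_cancel, MX_zero, one_mul, MZ_add,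
    add_neg_cancel, MZ_zero]

lemma orth_mul {A B : Matrix (Fin 3) (Fin 3) ℝ} (hA : A.transpose * A = 1)
    (hB : B.transpose * B = 1) : (A * B).transpose * (A * B) = 1 := by
  rw [Matrix.transpose_mul, mul_assoc, ← mul_assoc A.transpose, hA, one_mul, hB]

lemma MZ_orth (a : ℝ) : (MZ a).transpose * MZ a = 1 := by
  rw [MZ_tr, MZ_add, neg_add_cancel, MZ_zero]
lemma MX_orth (a : ℝ) : (MX a).transpose * MX a = 1 := by
  rw [MX_tr, MX_add, neg_add_cancel, MX_zero]
lemma MY_orth (a : ℝ) : (MY a).transpose * MY a = 1 := by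
  rw [MY_tr, MY_add, neg_add_cancel, MY_zero]

lemma famB_orth (p q : ℤ) (u s : ℝ) : (famB p q u s).transpose * famB p q u s = 1 :=
  orth_mul (orth_mul (MZ_orth _) (orth_mul (orth_mul (MY_orth _) (MX_orth _)) (MY_orth _)))
    (orth_mul (MX_orth _) (MZ_orth _))

lemma famB_cont (p q : ℤ) : Continuous (fun x : ℝ × ℝ => famB p q x.1 x.2) := by
  have := continuous_MX
  have := continuous_MY
  have := continuous_MZ
  unfold famB; fun_prop

lemma famB_u_one (p q : ℤ) (s : ℝ) :
    famB p q 1 s * (MZ (p * Real.pi * s) * MX (q * (2 * Real.pi) * s))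
      = MZ (((p + 2 * q : ℤ) : ℝ) * Real.pi * s) := by
  unfold famB
  rw [one_mul, MYXY, MZ_add]
  rw [mul_assoc, mul_assoc (MX _), ← mul_assoc (MZ (-_)), MZ_add, neg_add_cancel, MZ_zero, one_mul,
    MX_add, neg_add_cancel, MX_zero, mul_one]
  congr 1; push_cast; ring

/-- Periodized family. -/
noncomputable def famP (p q : ℤ) (u s : ℝ) : Matrix (Fin 3) (Fin 3) ℝ :=
  famB p q u (Int.fract s)

lemma famP_eq (p q : ℤ) (u : ℝ) {s : ℝ} (hs : s ∈ Set.Icc (0:ℝ) 1) :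
    famP p q u s = famB p q u s := by
  unfold famP
  rcases hs.2.eq_or_lt with h | h
  · rw [h, Int.fract_one, famB_at_zero, famB_at_one]
  · rw [Int.fract_eq_self.mpr ⟨hs.1, h⟩]

lemma famP_good (p q : ℤ) : GoodFam (famP p q) where
  cont := by
    have h1 := ContinuousOn.comp_fract' (f := famB p q) (famB_cont p q).continuousOn
      (fun s => by rw [famB_at_zero, famB_at_one])
    exact h1
  orth u s := famB_orth _ _ _ _
  per u s := by unfold famP; rw [Int.fract_add_one]
  zero s := famB_u_zero _ _ _

lemma image_strand (p q : ℤ) (k : Set (Fin 3 → ℝ)) (hk : ∀ v ∈ k, sqC v ≤ 1 / 2) :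
    amb (famP p q) 1 '' strandSet p q k = strandSet (p + 2 * q) 0 k := by
  have key : ∀ s ∈ Set.Icc (0:ℝ) 1, ∀ v ∈ k,
      amb (famP p q) 1 (spinMap (rotZ ((p : ℝ) * Real.pi * s)
        (rotAx ((q : ℝ) * (2 * Real.pi) * s) v)) s) =
      spinMap (rotZ (((p + 2 * q : ℤ) : ℝ) * Real.pi * s)
        (rotAx (((0 : ℤ) : ℝ) * (2 * Real.pi) * s) v)) s := by
    intro s hs v hv
    have h0 : rotAx (((0 : ℤ) : ℝ) * (2 * Real.pi) * s) v = v := by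
      rw [rotAx_eq]; simp [MX_zero, rotC_one]
    rw [h0, rotZ_eq, rotZ_eq, rotAx_eq, rotC_rotC]
    have hn : sqC (rotC (MZ (p * Real.pi * s) * MX (q * (2 * Real.pi) * s)) v) ≤ 1 / 2 := by
      rw [sqC_rotC (orth_mul (MZ_orth _) (MX_orth _))]; exact hk v hv
    have hpos : 0 ≤ rotC (MZ (p * Real.pi * s) * MX (q * (2 * Real.pi) * s)) v 2 := by
      have h2 := hn
      rw [sqC_eq] at h2
      generalize rotC (MZ (p * Real.pi * s) * MX (q * (2 * Real.pi) * s)) v = x at h2 ⊢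
      nlinarith [sq_nonneg (x 0), sq_nonneg (x 1)]
    rw [amb_spin (famP_good p q) 1 hpos, cutC_one hn, mul_one, famP_eq p q 1 hs, rotC_rotC,
      famB_u_one]
  ext w
  constructor
  · rintro ⟨_, ⟨s, hs, v, hv, rfl⟩, rfl⟩
    exact ⟨s, hs, v, hv, key s hs v hv⟩
  · rintro ⟨s, hs, v, hv, rfl⟩
    exact ⟨_, ⟨s, hs, v, hv, rfl⟩, key s hs v hv⟩

/-- Lemma 4.1 (i): the strands `S^{p,q}` and `S^{p+2q,0}` are ambient isotopic in ℝ⁴. -/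
theorem strand_pq_isotopic_p_add_two_q (p q : ℤ) :
    AmbientIsotopic (strandFam p q) (strandFam (p + 2 * q) 0) := by
  have hg := famP_good p q
  refine ⟨ambHomeo hg, continuous_amb hg, continuous_amb hg.transpose, ?_, ?_⟩
  · ext1 w
    change amb (famP p q) 0 w = w
    unfold amb
    rw [zero_mul, hg.zero, rotC_one, spin_base_ang]
  · intro i
    change amb (famP p q) 1 '' _ = _
    fin_cases i
    · refine image_strand p q hopfK1 ?_
      rintro v ⟨h1, h2⟩
      rw [sqC_eq, h1]; nlinarith
    · refine image_strand p q hopfK2 ?_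
      rintro v ⟨h1, h2⟩
      rw [sqC_eq, h1]; nlinarith [sq_nonneg (v 1)]
end

section
/- If integers p and p' satisfy p ≡ p' (mod 4), then for every integer q the strands S^{p,q} and S^{p',q} are ambient isotopic in ℝ⁴. -/
/-! ### Helpers -/

/-- Squared distance to the centre `(0,0,2)` of the ball. -/
def r2 (v : Fin 3 → ℝ) : ℝ := v 0 ^ 2 + v 1 ^ 2 + (v 2 - 2) ^ 2

/-- Cutoff function: `1` on the unit ball, `0` outside the ball of radius `√2`. -/
noncomputable def rho (v : Fin 3 → ℝ) : ℝ := max 0 (min 1 (2 - r2 v))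

/-- The half-space coordinate of a point of ℝ⁴. -/
noncomputable def halfPt (w : R4) : Fin 3 → ℝ := ![w 0, w 1, Real.sqrt (w 2 ^ 2 + w 3 ^ 2)]

/-- The page coordinate of a point of ℝ⁴. -/
noncomputable def page (w : R4) : ℝ := Complex.arg ⟨w 2, w 3⟩ / (2 * Real.pi)

/-- Commutator of rotations. -/
noncomputable def comM (θ α : ℝ) (v : Fin 3 → ℝ) : Fin 3 → ℝ :=
  rotZ θ (rotAx α (rotZ (-θ) (rotAx (-α) v)))

/-- Inverse of `comM`. -/
noncomputable def comN (θ α : ℝ) (v : Fin 3 → ℝ) : Fin 3 → ℝ :=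
  rotAx α (rotZ θ (rotAx (-α) (rotZ (-θ) v)))

lemma rotZ_add (a b : ℝ) (v : Fin 3 → ℝ) : rotZ a (rotZ b v) = rotZ (a + b) v := by
  ext i; fin_cases i <;> simp [rotZ, Real.cos_add, Real.sin_add] <;> ring

lemma rotAx_add (a b : ℝ) (v : Fin 3 → ℝ) : rotAx a (rotAx b v) = rotAx (a + b) v := by
  ext i; fin_cases i <;> simp [rotAx, Real.cos_add, Real.sin_add] <;> ring

lemma rotZ_zero (v : Fin 3 → ℝ) : rotZ 0 v = v := by
  ext i; fin_cases i <;> simp [rotZ]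

lemma rotAx_zero (v : Fin 3 → ℝ) : rotAx 0 v = v := by
  ext i; fin_cases i <;> simp [rotAx]

lemma r2_rotZ (a : ℝ) (v : Fin 3 → ℝ) : r2 (rotZ a v) = r2 v := by
  simp only [r2, rotZ, Matrix.cons_val]
  linear_combination (v 0 ^ 2 + v 1 ^ 2) * Real.sin_sq_add_cos_sq a

lemma r2_rotAx (a : ℝ) (v : Fin 3 → ℝ) : r2 (rotAx a v) = r2 v := by
  simp only [r2, rotAx, Matrix.cons_val]
  linear_combination (v 1 ^ 2 + (v 2 - 2) ^ 2) * Real.sin_sq_add_cos_sq a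

lemma rotZ_period (a : ℝ) (n : ℤ) (v : Fin 3 → ℝ) :
    rotZ (a + n * (2 * Real.pi)) v = rotZ a v := by
  simp [rotZ, Real.cos_add_int_mul_two_pi, Real.sin_add_int_mul_two_pi]

lemma rotZ_neg_period (a : ℝ) (n : ℤ) (v : Fin 3 → ℝ) :
    rotZ (-(a + n * (2 * Real.pi))) v = rotZ (-a) v := by
  have := rotZ_period (-a) (-n) v
  rw [← this]; congr 1; push_cast; ring

lemma comM_pi (θ : ℝ) (v : Fin 3 → ℝ) : comM θ Real.pi v = rotZ (2 * θ) v := by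
  ext i; fin_cases i <;> simp [comM, rotZ, rotAx, Real.cos_two_mul, Real.sin_two_mul]
  · linear_combination (-v 0) * Real.sin_sq_add_cos_sq θ
  · linear_combination (-v 1) * Real.sin_sq_add_cos_sq θ

structure Good (Φ : ℝ → ℝ → (Fin 3 → ℝ) → (Fin 3 → ℝ)) : Prop where
  cont : Continuous fun x : ℝ × ℝ × (Fin 3 → ℝ) => Φ x.1 x.2.1 x.2.2
  zero : ∀ θ v, Φ θ 0 v = v
  rad : ∀ θ α v, r2 (Φ θ α v) = r2 v
  per : ∀ θ α v (n : ℤ), Φ (θ + n * (2 * Real.pi)) α v = Φ θ α v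

lemma cont_rotZ : Continuous fun x : ℝ × (Fin 3 → ℝ) => rotZ x.1 x.2 := by
  refine continuous_pi fun i => ?_
  fin_cases i <;> simp [rotZ] <;> fun_prop

lemma cont_rotAx : Continuous fun x : ℝ × (Fin 3 → ℝ) => rotAx x.1 x.2 := by
  refine continuous_pi fun i => ?_
  fin_cases i <;> simp [rotAx] <;> fun_prop

lemma cont_spin : Continuous fun x : (Fin 3 → ℝ) × ℝ => spinMap x.1 x.2 := by
  refine continuous_pi fun i => ?_
  fin_cases i <;> simp [spinMap] <;> fun_prop

lemma cont_rotZ_comp {X : Type*} [TopologicalSpace X] {f : X → ℝ} {g : X → (Fin 3 → ℝ)}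
    (hf : Continuous f) (hg : Continuous g) : Continuous fun x => rotZ (f x) (g x) :=
  cont_rotZ.comp (hf.prodMk hg)

lemma cont_rotAx_comp {X : Type*} [TopologicalSpace X] {f : X → ℝ} {g : X → (Fin 3 → ℝ)}
    (hf : Continuous f) (hg : Continuous g) : Continuous fun x => rotAx (f x) (g x) :=
  cont_rotAx.comp (hf.prodMk hg)

lemma good_M : Good comM where
  cont := by
    unfold comM
    exact cont_rotZ_comp (by fun_prop) (cont_rotAx_comp (by fun_prop)
      (cont_rotZ_comp (by fun_prop) (cont_rotAx_comp (by fun_prop) (by fun_prop))))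
  zero θ v := by simp [comM, rotAx_zero, rotZ_add, rotZ_zero]
  rad θ α v := by simp [comM, r2_rotZ, r2_rotAx]
  per θ α v n := by simp only [comM, rotZ_period, rotZ_neg_period]

lemma good_N : Good comN where
  cont := by
    unfold comN
    exact cont_rotAx_comp (by fun_prop) (cont_rotZ_comp (by fun_prop)
      (cont_rotAx_comp (by fun_prop) (cont_rotZ_comp (by fun_prop) (by fun_prop))))
  zero θ v := by simp [comN, rotAx_zero, rotZ_add, rotZ_zero]
  rad θ α v := by simp [comN, r2_rotZ, r2_rotAx]
  per θ α v n := by simp only [comN, rotZ_period, rotZ_neg_period]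

lemma NM (θ α : ℝ) (v : Fin 3 → ℝ) : comN θ α (comM θ α v) = v := by
  simp [comM, comN, rotAx_zero, rotZ_add, rotZ_zero, rotAx_add]

lemma MN (θ α : ℝ) (v : Fin 3 → ℝ) : comM θ α (comN θ α v) = v := by
  simp [comM, comN, rotAx_zero, rotZ_add, rotZ_zero, rotAx_add]

/-- The map of ℝ⁴ which applies `Φ` page by page, cut off away from the solid torus. -/
noncomputable def spinG (Φ : ℝ → ℝ → (Fin 3 → ℝ) → (Fin 3 → ℝ)) (m : ℤ) (u : ℝ) (w : R4) : R4 :=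
  spinMap (Φ (2 * Real.pi * m * page w) (u * Real.pi * rho (halfPt w)) (halfPt w)) (page w)

lemma spin_page (w : R4) : spinMap (halfPt w) (page w) = w := by
  have h1 : 2 * Real.pi * page w = Complex.arg ⟨w 2, w 3⟩ := by
    unfold page; field_simp
  have h2 : Real.sqrt (w 2 ^ 2 + w 3 ^ 2) = ‖(⟨w 2, w 3⟩ : ℂ)‖ := by
    rw [Complex.norm_def, Complex.normSq_mk]; congr 1; ring
  ext i
  fin_cases i <;> simp [spinMap, halfPt, h1, h2]

lemma halfPt_nonneg (w : R4) : 0 ≤ halfPt w 2 := by simp [halfPt]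

lemma halfPt_spin (v : Fin 3 → ℝ) (hv : 0 ≤ v 2) (s : ℝ) : halfPt (spinMap v s) = v := by
  ext i
  fin_cases i
  · simp [halfPt, spinMap]
  · simp [halfPt, spinMap]
  · simp only [halfPt, spinMap, Matrix.cons_val]
    rw [show (v 2 * Real.cos (2 * Real.pi * s)) ^ 2 + (v 2 * Real.sin (2 * Real.pi * s)) ^ 2
      = v 2 ^ 2 by linear_combination v 2 ^ 2 * Real.sin_sq_add_cos_sq (2 * Real.pi * s)]
    simp [Real.sqrt_sq hv]

lemma page_spin (v : Fin 3 → ℝ) (hv : 0 < v 2) (s : ℝ) :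
    ∃ n : ℤ, page (spinMap v s) = s + n := by
  have h := Complex.arg_mul_cos_add_sin_mul_I_coe_angle hv ((2 * Real.pi * s : ℝ) : Real.Angle)
  have e : ((v 2 : ℝ) : ℂ) * (Real.Angle.cos ((2 * Real.pi * s : ℝ) : Real.Angle) +
      Real.Angle.sin ((2 * Real.pi * s : ℝ) : Real.Angle) * Complex.I) =
      ⟨spinMap v s 2, spinMap v s 3⟩ := by
    apply Complex.ext <;> simp [spinMap, -Complex.ofReal_cos, -Complex.ofReal_sin]
  rw [e, Real.Angle.angle_eq_iff_two_pi_dvd_sub] at h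
  obtain ⟨k, hk⟩ := h
  refine ⟨k, ?_⟩
  have hpi := Real.pi_pos
  unfold page
  rw [div_eq_iff (by positivity)]
  linear_combination hk

lemma rho_zero {v : Fin 3 → ℝ} (h : 2 ≤ r2 v) : rho v = 0 := by
  unfold rho
  exact max_eq_left ((min_le_right _ _).trans (by linarith))

lemma rho_one {v : Fin 3 → ℝ} (h : r2 v ≤ 1) : rho v = 1 := by
  unfold rho
  rw [min_eq_left (by linarith)]; simp

lemma pos_of_r2 {v : Fin 3 → ℝ} (h : r2 v < 2) : 0 < v 2 := by
  unfold r2 at h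
  nlinarith [sq_nonneg (v 0), sq_nonneg (v 1)]

lemma spinMap_int (v : Fin 3 → ℝ) (s : ℝ) (n : ℤ) : spinMap v (s + n) = spinMap v s := by
  have : 2 * Real.pi * (s + n) = 2 * Real.pi * s + n * (2 * Real.pi) := by ring
  simp [spinMap, this, Real.cos_add_int_mul_two_pi, Real.sin_add_int_mul_two_pi]

lemma spinG_spin {Φ} (hΦ : Good Φ) (m : ℤ) (u : ℝ) (v : Fin 3 → ℝ) (hv : 0 ≤ v 2) (s : ℝ) :
    spinG Φ m u (spinMap v s) =
      spinMap (Φ (2 * Real.pi * m * s) (u * Real.pi * rho v) v) s := by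
  unfold spinG
  rw [halfPt_spin v hv]
  by_cases h : 2 ≤ r2 v
  · rw [rho_zero h, mul_zero, hΦ.zero, hΦ.zero]
    have := spin_page (spinMap v s)
    rwa [halfPt_spin v hv] at this
  · obtain ⟨n, hn⟩ := page_spin v (pos_of_r2 (not_le.1 h)) s
    rw [hn, spinMap_int]
    have : 2 * Real.pi * m * (s + n) = 2 * Real.pi * m * s + (m * n : ℤ) * (2 * Real.pi) := by
      push_cast; ring
    rw [this, hΦ.per]

lemma good_nonneg {Φ} (hΦ : Good Φ) (θ u : ℝ) (v : Fin 3 → ℝ) (hv : 0 ≤ v 2) :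
    0 ≤ Φ θ (u * Real.pi * rho v) v 2 := by
  by_cases h : 2 ≤ r2 v
  · rwa [rho_zero h, mul_zero, hΦ.zero]
  · exact (pos_of_r2 (by rw [hΦ.rad]; exact not_le.1 h)).le

lemma rho_good {Φ} (hΦ : Good Φ) (θ α : ℝ) (v : Fin 3 → ℝ) : rho (Φ θ α v) = rho v := by
  simp [rho, hΦ.rad]

lemma spinG_inv {Φ Ψ} (hΦ : Good Φ) (hΨ : Good Ψ) (hi : ∀ θ α v, Ψ θ α (Φ θ α v) = v)
    (m : ℤ) (u : ℝ) (w : R4) : spinG Ψ m u (spinG Φ m u w) = w := by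
  have h0 := halfPt_nonneg w
  have hw := spin_page w
  generalize halfPt w = v at h0 hw
  generalize page w = s at hw
  subst hw
  rw [spinG_spin hΦ m u v h0, spinG_spin hΨ m u _ (good_nonneg hΦ _ _ _ h0),
    rho_good hΦ, hi]

lemma cont_halfPt : Continuous halfPt := by
  refine continuous_pi fun i => ?_
  fin_cases i <;> simp [halfPt] <;> fun_prop

lemma cont_r2 : Continuous r2 := by unfold r2; fun_prop

lemma cont_rho : Continuous rho := by
  have := cont_r2
  unfold rho; fun_prop

lemma contAt_of_page {Φ} (hΦ : Good Φ) (m : ℤ) (t : R4 → ℝ) (w : R4) (u : ℝ)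
    (ht : ContinuousAt t w) (h : ∀ w, spinMap (halfPt w) (t w) = w) :
    ContinuousAt (fun x : R4 × ℝ => spinG Φ m x.2 x.1) (w, u) := by
  have e : (fun x : R4 × ℝ => spinG Φ m x.2 x.1) = fun x : R4 × ℝ =>
      spinMap (Φ (2 * Real.pi * m * t x.1) (x.2 * Real.pi * rho (halfPt x.1)) (halfPt x.1))
        (t x.1) := by
    funext x
    have := spinG_spin hΦ m x.2 (halfPt x.1) (halfPt_nonneg _) (t x.1)
    rwa [h] at this
  rw [e]
  have h1 : ContinuousAt (fun x : R4 × ℝ => t x.1) (w, u) :=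
    ContinuousAt.comp (f := Prod.fst) (g := t) ht continuousAt_fst
  have h2 : ContinuousAt (fun x : R4 × ℝ => halfPt x.1) (w, u) :=
    (cont_halfPt.comp continuous_fst).continuousAt
  have h3 : ContinuousAt (fun x : R4 × ℝ => rho (halfPt x.1)) (w, u) :=
    (cont_rho.comp (cont_halfPt.comp continuous_fst)).continuousAt
  have h4 : ContinuousAt (fun x : R4 × ℝ => Φ (2 * Real.pi * m * t x.1)
      (x.2 * Real.pi * rho (halfPt x.1)) (halfPt x.1)) (w, u) :=
    ContinuousAt.comp (g := fun x : ℝ × ℝ × (Fin 3 → ℝ) => Φ x.1 x.2.1 x.2.2)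
      (f := fun x : R4 × ℝ => (2 * Real.pi * m * t x.1, x.2 * Real.pi * rho (halfPt x.1),
        halfPt x.1)) hΦ.cont.continuousAt
      ((continuousAt_const.mul h1).prodMk
        (((continuousAt_snd.mul continuousAt_const).mul h3).prodMk h2))
  exact ContinuousAt.comp (g := fun x : (Fin 3 → ℝ) × ℝ => spinMap x.1 x.2)
      cont_spin.continuousAt (h4.prodMk h1)

/-- Another branch of the page coordinate. -/
noncomputable def page' (w : R4) : ℝ := page (-w) + 1 / 2

lemma spin_page' (w : R4) : spinMap (halfPt w) (page' w) = w := by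
  have h := spin_page (-w)
  have e : 2 * Real.pi * page' w = 2 * Real.pi * page (-w) + Real.pi := by
    unfold page'; ring
  have h2 := congrFun h 2
  have h3 := congrFun h 3
  simp [spinMap, halfPt] at h2 h3
  ext i
  fin_cases i <;> simp [spinMap, halfPt, e, Real.cos_add_pi, Real.sin_add_pi, h2, h3]

lemma contAt_page (w : R4) (h : (⟨w 2, w 3⟩ : ℂ) ∈ Complex.slitPlane) : ContinuousAt page w := by
  unfold page
  have hc : Continuous fun w : R4 => (⟨w 2, w 3⟩ : ℂ) := by
    have : (fun w : R4 => (⟨w 2, w 3⟩ : ℂ)) = fun w : R4 => (w 2 : ℂ) + (w 3 : ℂ) * Complex.I := by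
      funext w; apply Complex.ext <;> simp
    rw [this]; fun_prop
  exact (ContinuousAt.comp (f := fun w : R4 => (⟨w 2, w 3⟩ : ℂ))
    (Complex.continuousAt_arg h) hc.continuousAt).div_const _

lemma contAt_page' (w : R4) (h : (⟨-w 2, -w 3⟩ : ℂ) ∈ Complex.slitPlane) :
    ContinuousAt page' w := by
  unfold page'
  have : ContinuousAt page (-w) := contAt_page (-w) h
  exact (ContinuousAt.comp (f := fun w : R4 => -w) this continuous_neg.continuousAt).add
    continuousAt_const

lemma cont_spinG {Φ} (hΦ : Good Φ) (m : ℤ) :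
    Continuous (fun x : R4 × ℝ => spinG Φ m x.2 x.1) := by
  rw [continuous_iff_continuousAt]
  rintro ⟨w, u⟩
  by_cases h1 : (⟨w 2, w 3⟩ : ℂ) ∈ Complex.slitPlane
  · exact contAt_of_page hΦ m page w u (contAt_page w h1) spin_page
  by_cases h2 : (⟨-w 2, -w 3⟩ : ℂ) ∈ Complex.slitPlane
  · exact contAt_of_page hΦ m page' w u (contAt_page' w h2) spin_page'
  simp only [Complex.mem_slitPlane_iff, not_or, not_lt, not_not, neg_eq_zero] at h1 h2
  have e2 : w 2 = 0 := by linarith [h1.1, h2.1]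
  have hr : 2 < r2 (halfPt w) := by
    simp only [r2, halfPt, Matrix.cons_val, e2, h1.2]
    norm_num
    nlinarith [sq_nonneg (w 0), sq_nonneg (w 1)]
  have hev : ∀ᶠ x : R4 × ℝ in nhds (w, u), 2 < r2 (halfPt x.1) :=
    (cont_r2.comp (cont_halfPt.comp continuous_fst)).continuousAt.eventually_const_lt hr
  refine ContinuousAt.congr (f := Prod.fst) continuousAt_fst ?_
  filter_upwards [hev] with x hx
  unfold spinG
  rw [rho_zero hx.le, mul_zero, hΦ.zero, spin_page]

lemma cont_spinG_at {Φ} (hΦ : Good Φ) (m : ℤ) (u : ℝ) : Continuous (spinG Φ m u) := by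
  have h : Continuous (fun w : R4 => (w, u)) := by fun_prop
  exact Continuous.comp (g := fun x : R4 × ℝ => spinG Φ m x.2 x.1) (cont_spinG hΦ m) h

/-- The homeomorphism at time `u`. -/
noncomputable def isoH (m : ℤ) (u : ℝ) : R4 ≃ₜ R4 where
  toFun := spinG comM m u
  invFun := spinG comN m u
  left_inv := spinG_inv good_M good_N NM m u
  right_inv := spinG_inv good_N good_M MN m u
  continuous_toFun := cont_spinG_at good_M m u
  continuous_invFun := cont_spinG_at good_N m u

lemma isoH_strand (m p q : ℤ) (s : ℝ) (v : Fin 3 → ℝ) (hv : r2 v ≤ 1) :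
    isoH m 1 (spinMap (rotZ ((p : ℝ) * Real.pi * s) (rotAx ((q : ℝ) * (2 * Real.pi) * s) v)) s) =
      spinMap (rotZ (((p + 4 * m : ℤ) : ℝ) * Real.pi * s)
        (rotAx ((q : ℝ) * (2 * Real.pi) * s) v)) s := by
  set x := rotAx ((q : ℝ) * (2 * Real.pi) * s) v with hx
  have hr : r2 (rotZ ((p : ℝ) * Real.pi * s) x) ≤ 1 := by rwa [r2_rotZ, hx, r2_rotAx]
  change spinG comM m 1 _ = _
  rw [spinG_spin good_M m 1 _ (pos_of_r2 (by linarith)).le, rho_one hr, one_mul, mul_one,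
    comM_pi, rotZ_add]
  congr 2
  push_cast; ring

lemma isoH_image (m p q : ℤ) (k : Set (Fin 3 → ℝ)) (hk : ∀ v ∈ k, r2 v ≤ 1) :
    isoH m 1 '' strandSet p q k = strandSet (p + 4 * m) q k := by
  ext w
  constructor
  · rintro ⟨_, ⟨s, hs, v, hv, rfl⟩, rfl⟩
    exact ⟨s, hs, v, hv, isoH_strand m p q s v (hk v hv)⟩
  · rintro ⟨s, hs, v, hv, rfl⟩
    exact ⟨_, ⟨s, hs, v, hv, rfl⟩, isoH_strand m p q s v (hk v hv)⟩

lemma r2_K1 (v : Fin 3 → ℝ) (hv : v ∈ hopfK1) : r2 v ≤ 1 := by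
  obtain ⟨h1, h2⟩ := hv
  unfold r2; rw [h1]; nlinarith

lemma r2_K2 (v : Fin 3 → ℝ) (hv : v ∈ hopfK2) : r2 v ≤ 1 := by
  obtain ⟨h1, h2⟩ := hv
  unfold r2; rw [h1]; nlinarith [sq_nonneg (v 1), sq_nonneg (v 2 - 9 / 4 - 1 / 4)]

/-- Lemma 4.1 (ii): if `p ≡ p' (mod 4)` then the strands `S^{p,q}` and `S^{p',q}` are
ambient isotopic in ℝ⁴. -/
theorem strand_isotopic_of_mod_four (p p' : ℤ) (h : p ≡ p' [ZMOD 4]) (q : ℤ) :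
    AmbientIsotopic (strandFam p q) (strandFam p' q) := by
  obtain ⟨m, hm⟩ := h.dvd
  obtain rfl : p' = p + 4 * m := by linarith
  refine ⟨isoH m, cont_spinG good_M m, cont_spinG good_N m, ?_, ?_⟩
  · ext1 w
    change spinG comM m 0 w = w
    unfold spinG
    rw [zero_mul, zero_mul, good_M.zero, spin_page]
  · intro i
    fin_cases i
    · exact isoH_image m p q hopfK1 r2_K1
    · exact isoH_image m p q hopfK2 r2_K2
end

section
/- For all integers p, all m ≥ 0 and all labels i, j, k_1,…,k_m ∈ {1,…,n}, the labelled necklaces N^p(i,j;k_1,…,k_m) and N^{−p}(j,i;k_1,…,k_m) are ambient isotopic in ℝ⁴ as labelled n-component surface-links. -/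
/-- Squared distance to the centre `(0,0,17/8)`. -/
noncomputable def nkRho (v : Fin 3 → ℝ) : ℝ := (v 0) ^ 2 + (v 1) ^ 2 + (v 2 - 17 / 8) ^ 2

/-- Cutoff: `1` for `t ≤ (3/8)²`, `0` for `t ≥ (3/4)²`. -/
noncomputable def nkCut (t : ℝ) : ℝ := max 0 (min 1 ((9 / 16 - t) * (64 / 27)))

/-- Rotation by angle `φ` about the axis `{x = y, z = 17/8}`. -/
noncomputable def nkRot (φ : ℝ) (v : Fin 3 → ℝ) : Fin 3 → ℝ :=
  ![(v 0 + v 1) / 2 + (v 0 - v 1) / 2 * Real.cos φ - (v 2 - 17 / 8) * Real.sin φ / √2,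
    (v 0 + v 1) / 2 - (v 0 - v 1) / 2 * Real.cos φ + (v 2 - 17 / 8) * Real.sin φ / √2,
    17 / 8 + (v 0 - v 1) / √2 * Real.sin φ + (v 2 - 17 / 8) * Real.cos φ]

/-- The cut-off rotation of the ball. -/
noncomputable def nkG (u : ℝ) (v : Fin 3 → ℝ) : Fin 3 → ℝ :=
  nkRot (u * Real.pi * nkCut (nkRho v)) v

/-- Spinning with given cosine and sine. -/
def nkSpin (v : Fin 3 → ℝ) (c s : ℝ) : R4 := ![v 0, v 1, v 2 * c, v 2 * s]

noncomputable def nkRad (w : R4) : ℝ := √((w 2) ^ 2 + (w 3) ^ 2)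

noncomputable def nkBase (w : R4) : Fin 3 → ℝ := ![w 0, w 1, nkRad w]

/-- The spun cut-off rotation on ℝ⁴. -/
noncomputable def nkH (u : ℝ) (w : R4) : R4 :=
  ![nkG u (nkBase w) 0, nkG u (nkBase w) 1,
    w 2 * (1 + (nkG u (nkBase w) 2 - nkRad w) / max (nkRad w) 1),
    w 3 * (1 + (nkG u (nkBase w) 2 - nkRad w) / max (nkRad w) 1)]

theorem nkRot_zero (v : Fin 3 → ℝ) : nkRot 0 v = v := by
  ext a
  fin_cases a <;> simp [nkRot] <;> ring

theorem nkRot_rho (φ : ℝ) (v : Fin 3 → ℝ) : nkRho (nkRot φ v) = nkRho v := by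
  have h2 : (√2 : ℝ)⁻¹ ^ 2 = 1 / 2 := by
    rw [inv_pow, Real.sq_sqrt (by norm_num)]; norm_num
  have hcs := Real.sin_sq_add_cos_sq φ
  simp only [nkRho, nkRot, Matrix.cons_val_zero, Matrix.cons_val_one, Matrix.cons_val, div_eq_mul_inv _ √2]
  generalize (√2 : ℝ)⁻¹ = t at *
  generalize Real.cos φ = c at *
  generalize Real.sin φ = s at *
  have hs : s ^ 2 = 1 - c ^ 2 := by linarith
  linear_combination (2 * (v 2 - 17/8)^2 * s^2 + (v 0 - v 1)^2 * s^2) * h2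
    + ((v 2 - 17/8)^2 + (v 0 - v 1)^2/2) * hs

theorem nkRot_neg (φ : ℝ) (v : Fin 3 → ℝ) : nkRot (-φ) (nkRot φ v) = v := by
  have h2 : (√2 : ℝ)⁻¹ ^ 2 = 1 / 2 := by
    rw [inv_pow, Real.sq_sqrt (by norm_num)]; norm_num
  have hcs := Real.sin_sq_add_cos_sq φ
  ext a
  fin_cases a <;>
  simp only [nkRot, Matrix.cons_val_zero, Matrix.cons_val_one, Matrix.cons_val, div_eq_mul_inv _ √2,
    Real.cos_neg, Real.sin_neg, Fin.zero_eta, Fin.mk_one, Fin.reduceFinMk] <;>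
  generalize (√2 : ℝ)⁻¹ = t at * <;>
  generalize Real.cos φ = c at * <;>
  generalize Real.sin φ = s at *
  · linear_combination (v 0 - v 1) * s^2 * h2 + (v 0 - v 1)/2 * hcs
  · linear_combination -(v 0 - v 1) * s^2 * h2 - (v 0 - v 1)/2 * hcs
  · linear_combination 2 * (v 2 - 17/8) * s^2 * h2 + (v 2 - 17/8) * hcs

theorem nkG_rho (u : ℝ) (v : Fin 3 → ℝ) : nkRho (nkG u v) = nkRho v := nkRot_rho _ v

theorem nkG_neg (u : ℝ) (v : Fin 3 → ℝ) : nkG (-u) (nkG u v) = v := by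
  unfold nkG
  rw [nkRot_rho, neg_mul, neg_mul, nkRot_neg]

theorem nkG_zero (v : Fin 3 → ℝ) : nkG 0 v = v := by
  simp [nkG, nkRot_zero]

theorem nkG_far (u : ℝ) (v : Fin 3 → ℝ) (h : 9 / 16 ≤ nkRho v) : nkG u v = v := by
  have : nkCut (nkRho v) = 0 := by
    unfold nkCut
    apply max_eq_left
    apply (min_le_right _ _).trans
    linarith
  simp [nkG, this, nkRot_zero]

theorem nkG_near (v : Fin 3 → ℝ) (h : nkRho v ≤ 9 / 64) :
    nkG 1 v = ![v 1, v 0, 17 / 4 - v 2] := by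
  have : nkCut (nkRho v) = 1 := by
    unfold nkCut
    rw [min_eq_left (by linarith)]
    norm_num
  ext a
  fin_cases a <;> simp [nkG, this, nkRot] <;> ring

theorem nkG_low (u : ℝ) (v : Fin 3 → ℝ) (h : v 2 ≤ 1) : nkG u v = v := by
  apply nkG_far
  unfold nkRho
  nlinarith [sq_nonneg (v 0), sq_nonneg (v 1)]

theorem nkG_high (u : ℝ) (v : Fin 3 → ℝ) (h : 1 ≤ v 2) : 1 ≤ nkG u v 2 := by
  by_contra hc
  push Not at hc
  have h1 := nkG_low (-u) (nkG u v) hc.le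
  rw [nkG_neg] at h1
  rw [← h1] at hc
  linarith

theorem nkH_spin (u : ℝ) (v : Fin 3 → ℝ) (c s : ℝ) (hcs : c ^ 2 + s ^ 2 = 1) (h : 1 ≤ v 2) :
    nkH u (nkSpin v c s) = nkSpin (nkG u v) c s := by
  have hr : nkRad (nkSpin v c s) = v 2 := by
    unfold nkRad nkSpin
    simp only [Matrix.cons_val]
    rw [show (v 2 * c) ^ 2 + (v 2 * s) ^ 2 = (v 2) ^ 2 by linear_combination (v 2)^2 * hcs]
    exact Real.sqrt_sq (by linarith)
  have hb : nkBase (nkSpin v c s) = v := by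
    ext a
    fin_cases a <;> simp [nkBase, hr] <;> simp [nkSpin]
  have hv : v 2 ≠ 0 := by linarith
  unfold nkH
  rw [hb, hr, max_eq_left h]
  ext a
  fin_cases a <;> simp [nkSpin] <;> field_simp <;> ring

theorem nkH_low (u : ℝ) (w : R4) (h : nkRad w ≤ 1) : nkH u w = w := by
  have hb : nkG u (nkBase w) = nkBase w := nkG_low _ _ (by simpa [nkBase] using h)
  unfold nkH
  rw [hb]
  ext a
  fin_cases a <;> simp [nkBase]

theorem nkH_neg (u : ℝ) (w : R4) : nkH (-u) (nkH u w) = w := by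
  rcases le_total (nkRad w) 1 with h | h
  · rw [nkH_low _ _ h, nkH_low _ _ h]
  · have hr : nkRad w ≠ 0 := by linarith
    have hsq : nkRad w ^ 2 = (w 2) ^ 2 + (w 3) ^ 2 := Real.sq_sqrt (by positivity)
    have hcs : (w 2 / nkRad w) ^ 2 + (w 3 / nkRad w) ^ 2 = 1 := by
      field_simp
      linarith
    have hw : w = nkSpin (nkBase w) (w 2 / nkRad w) (w 3 / nkRad w) := by
      ext a
      fin_cases a <;> simp [nkSpin, nkBase] <;> field_simp
    have hz : 1 ≤ nkBase w 2 := by simpa [nkBase] using h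
    have e1 := nkH_spin u (nkBase w) _ _ hcs hz
    have e2 := nkH_spin (-u) (nkG u (nkBase w)) _ _ hcs (nkG_high _ _ hz)
    rw [← hw] at e1
    rw [e1, e2, nkG_neg, ← hw]

theorem nkH_zero (w : R4) : nkH 0 w = w := by
  unfold nkH
  rw [nkG_zero]
  ext a
  fin_cases a <;> simp [nkBase]

theorem nkCut_cont : Continuous nkCut := by
  unfold nkCut
  fun_prop

theorem nkH_cont : Continuous (fun q : R4 × ℝ => nkH q.2 q.1) := by
  have hr : Continuous (fun q : R4 × ℝ => nkRad q.1) := by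
    unfold nkRad
    fun_prop
  have hrho : Continuous (fun q : R4 × ℝ => nkCut (nkRho (nkBase q.1))) := by
    apply nkCut_cont.comp
    simp only [nkRho, nkBase, Matrix.cons_val_zero, Matrix.cons_val_one, Matrix.cons_val]
    fun_prop
  have hinv : Continuous (fun q : R4 × ℝ => (max (nkRad q.1) 1)⁻¹) := by
    apply Continuous.inv₀ (by fun_prop)
    intro q
    have := le_max_right (nkRad q.1) 1
    linarith
  have key : ∀ b : Fin 3, Continuous (fun q : R4 × ℝ => nkG q.2 (nkBase q.1) b) := by
    intro b
    unfold nkG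
    generalize hg : (fun q : R4 × ℝ => nkCut (nkRho (nkBase q.1))) = g at hrho
    have hg' : ∀ q : R4 × ℝ, nkCut (nkRho (nkBase q.1)) = g q := fun q => congrFun hg q
    simp only [hg']
    fin_cases b <;> simp [nkRot, nkBase] <;> fun_prop
  have k0 := key 0
  have k1 := key 1
  have k2 := key 2
  refine continuous_pi fun a => ?_
  fin_cases a <;> simp [nkH, div_eq_mul_inv] <;> fun_prop

/-- The ambient homeomorphisms. -/
noncomputable def nkHomeo (u : ℝ) : R4 ≃ₜ R4 where
  toFun := nkH u
  invFun := nkH (-u)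
  left_inv := nkH_neg u
  right_inv w := by simpa using nkH_neg (-u) w
  continuous_toFun := nkH_cont.comp (by fun_prop : Continuous fun w : R4 => (w, u))
  continuous_invFun := nkH_cont.comp (by fun_prop : Continuous fun w : R4 => (w, -u))

theorem nkH_spinMap (u : ℝ) (v : Fin 3 → ℝ) (s : ℝ) (h : 1 ≤ v 2) :
    nkH u (spinMap v s) = spinMap (nkG u v) s :=
  nkH_spin u v _ _ (Real.cos_sq_add_sin_sq _) h

theorem nkH_bead (u t : ℝ) : nkH u '' beadSet t = beadSet t := by
  have key : ∀ w ∈ beadSet t, nkH u w = w := by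
    rintro w ⟨v, hv, rfl⟩
    have h1 : 1 ≤ v 2 := by nlinarith [sq_nonneg (v 0), sq_nonneg (v 1)]
    have h3 : v 2 ≤ 3 := by nlinarith [sq_nonneg (v 0), sq_nonneg (v 1)]
    rw [nkH_spinMap _ _ _ h1, nkG_far]
    unfold nkRho
    nlinarith
  ext w
  constructor
  · rintro ⟨x, hx, rfl⟩
    rwa [key x hx]
  · intro hw
    exact ⟨w, hw, key w hw⟩

/-- The half-turn swapping the two Hopf components. -/
noncomputable def nkSwap (v : Fin 3 → ℝ) : Fin 3 → ℝ := ![v 1, v 0, 17 / 4 - v 2]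

theorem nkSwap_swap (v : Fin 3 → ℝ) : nkSwap (nkSwap v) = v := by
  ext a
  fin_cases a <;> simp [nkSwap]

theorem nkZ_rho (θ : ℝ) (v : Fin 3 → ℝ) : nkRho (rotZ θ v) = nkRho v := by
  simp only [nkRho, rotZ, Matrix.cons_val_zero, Matrix.cons_val_one, Matrix.cons_val]
  linear_combination ((v 0)^2 + (v 1)^2) * Real.sin_sq_add_cos_sq θ

theorem nkSwap_rotZ (θ : ℝ) (v : Fin 3 → ℝ) : nkSwap (rotZ θ v) = rotZ (-θ) (nkSwap v) := by
  ext a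
  fin_cases a <;> simp [nkSwap, rotZ] <;> ring

theorem nkH_point (p : ℤ) (s : ℝ) (v : Fin 3 → ℝ) (hv : nkRho v ≤ 9 / 64) :
    nkH 1 (spinMap (rotZ ((p : ℝ) * Real.pi * s) (rotAx (((0 : ℤ) : ℝ) * (2 * Real.pi) * s) v)) s)
    = spinMap (rotZ (((-p : ℤ) : ℝ) * Real.pi * s)
        (rotAx (((0 : ℤ) : ℝ) * (2 * Real.pi) * s) (nkSwap v))) s := by
  have ax : ∀ v, rotAx (((0 : ℤ) : ℝ) * (2 * Real.pi) * s) v = v := by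
    intro v
    ext a
    fin_cases a <;> simp [rotAx]
  rw [ax, ax]
  have h1 : 1 ≤ rotZ ((p : ℝ) * Real.pi * s) v 2 := by
    simp only [rotZ, Matrix.cons_val]
    unfold nkRho at hv
    nlinarith [sq_nonneg (v 0), sq_nonneg (v 1)]
  rw [nkH_spinMap _ _ _ h1, nkG_near _ (by rwa [nkZ_rho])]
  have := nkSwap_rotZ ((p : ℝ) * Real.pi * s) v
  unfold nkSwap at this ⊢
  rw [this]
  push_cast
  simp only [neg_mul]

theorem nkH_strand (p : ℤ) (K K' : Set (Fin 3 → ℝ)) (hb : ∀ v ∈ K, nkRho v ≤ 9 / 64)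
    (h1 : ∀ v ∈ K, nkSwap v ∈ K') (h2 : ∀ v ∈ K', nkSwap v ∈ K) :
    nkH 1 '' strandSet p 0 K = strandSet (-p) 0 K' := by
  ext w
  constructor
  · rintro ⟨x, ⟨s, hs, v, hv, rfl⟩, rfl⟩
    exact ⟨s, hs, nkSwap v, h1 v hv, nkH_point p s v (hb v hv)⟩
  · rintro ⟨s, hs, v, hv, rfl⟩
    refine ⟨_, ⟨s, hs, nkSwap v, h2 v hv, rfl⟩, ?_⟩
    rw [nkH_point p s _ (hb _ (h2 v hv)), nkSwap_swap]

theorem nkSwap_K1 : ∀ v ∈ hopfK1, nkSwap v ∈ hopfK2 := by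
  rintro v ⟨h1, h2⟩
  simp only [hopfK2, nkSwap, Set.mem_setOf_eq, Matrix.cons_val_zero, Matrix.cons_val_one,
    Matrix.cons_val]
  exact ⟨h1, by linarith⟩

theorem nkSwap_K2 : ∀ v ∈ hopfK2, nkSwap v ∈ hopfK1 := by
  rintro v ⟨h1, h2⟩
  simp only [hopfK1, nkSwap, Set.mem_setOf_eq, Matrix.cons_val_zero, Matrix.cons_val_one,
    Matrix.cons_val]
  exact ⟨h1, by linarith⟩

theorem nkRho_K1 : ∀ v ∈ hopfK1, nkRho v ≤ 9 / 64 := by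
  rintro v ⟨h1, h2⟩
  unfold nkRho
  have : 7 / 4 ≤ v 2 := by nlinarith [sq_nonneg (v 0)]
  rw [h1]
  nlinarith

theorem nkRho_K2 : ∀ v ∈ hopfK2, nkRho v ≤ 9 / 64 := by
  rintro v ⟨h1, h2⟩
  unfold nkRho
  have : v 2 ≤ 5 / 2 := by nlinarith [sq_nonneg (v 1)]
  rw [h1]
  nlinarith

/-- Lemma 4.4 (ii): the necklaces `N^p(i,j;k₁,…,k_m)` and `N^{-p}(j,i;k₁,…,k_m)` are
ambient isotopic in ℝ⁴ as labelled `n`-component surface-links. -/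
theorem necklace_label_swap_isotopic (n : ℕ) (p : ℤ) (i j : Fin n) (m : ℕ)
    (τ : Fin m → ℝ) (hmono : StrictMono τ) (hmem : ∀ s, τ s ∈ Set.Ioo (0:ℝ) 1)
    (k : Fin m → Fin n) :
    AmbientIsotopic (necklaceFam n p i j τ k) (necklaceFam n (-p) j i τ k) := by
  refine ⟨nkHomeo, nkH_cont, ?_, ?_, ?_⟩
  · exact nkH_cont.comp (by fun_prop : Continuous fun q : R4 × ℝ => (q.1, -q.2))
  · ext1 w
    exact nkH_zero w
  · intro a
    change nkH 1 '' _ = _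
    unfold necklaceFam
    simp only [Set.image_union, Set.image_iUnion, nkH_bead,
      nkH_strand p _ _ nkRho_K1 nkSwap_K1 nkSwap_K2,
      nkH_strand p _ _ nkRho_K2 nkSwap_K2 nkSwap_K1]
    congr 1
    exact Set.union_comm _ _
end
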